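/- Let G be a countable sofic group and let (X, μ) and (Y, ν) be standard probability spaces. Suppose that the Bernoulli actions (G, X^G, μ^G) and (G, Y^G, ν^G) are isomorphic, i.e., there exist G-invariant Borel sets X' ⊆ X^G and Y' ⊆ Y^G with μ^G(X') = ν^G(Y') = 1 and a Borel bijection T : X' → Y' with Borel inverse such that T_*(μ^G|_{X'}) = ν^G|_{Y'} and T(g·x) = g·T(x) for all g ∈ G and x ∈ X'. Then H(μ) = H(ν). -/

import Mathlib

open Filter MeasureTheory
open scoped ENNReal

/-- A sofic approximation sequence for a group `G`. -/
structure SoficApproxSeq (G : Type*) [Group G] where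
  d : ℕ → ℕ
  d_pos : ∀ i, 0 < d i
  σ : ∀ i, G → Equiv.Perm (Fin (d i))
  d_tendsto : Tendsto d atTop atTop
  almost_mul : ∀ s t : G,
    Tendsto (fun i =>
        (({k : Fin (d i) | σ i (s * t) k = σ i s (σ i t k)}.ncard : ℝ) / d i))
      atTop (nhds 1)
  almost_free : ∀ s t : G, s ≠ t →
    Tendsto (fun i =>
        (({k : Fin (d i) | σ i s k ≠ σ i t k}.ncard : ℝ) / d i))
      atTop (nhds 1)

/-- The shift `g · (x_h)_{h ∈ G} = (x_{g⁻¹h})_{h ∈ G}` of the Bernoulli action. -/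
def bernoulliShift {G X : Type*} [Group G] (g : G) (x : G → X) : G → X :=
  fun h => x (g⁻¹ * h)

/-- `μG` is the product measure `μ^G`: every finite cylinder has the product measure. -/
def IsBernoulliProductMeasure {G X : Type*} [MeasurableSpace X]
    (μ : Measure X) (μG : Measure (G → X)) : Prop :=
  ∀ (E : Finset G) (B : G → Set X), (∀ g ∈ E, MeasurableSet (B g)) →
    μG {x : G → X | ∀ g ∈ E, x g ∈ B g} = ∏ g ∈ E, μ (B g)

/-- `H(μ) ∈ [0,∞]`: the supremum of the Shannon entropies `H_μ(Q)` over all finite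
measurable partitions `Q` of `X`. -/
noncomputable def entropySup {X : Type*} [MeasurableSpace X] (μ : Measure X) : ℝ≥0∞ :=
  ⨆ (P : Finset (Set X)) (_ : (∀ A ∈ P, MeasurableSet A) ∧
      (P : Set (Set X)).PairwiseDisjoint id ∧ ⋃₀ (P : Set (Set X)) = Set.univ),
    ENNReal.ofReal (∑ A ∈ P, Real.negMulLog (μ A).toReal)

section ProductMeasure

variable {I G X : Type*} [MeasurableSpace X] {μ : Measure X}

theorem IsBernoulliProductMeasure.measurePreserving_eval {M : Measure (I → X)}
    (hM : IsBernoulliProductMeasure μ M) (i : I) :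
    MeasurePreserving (fun x : I → X => x i) M μ := by
  refine ⟨measurable_pi_apply i, Measure.ext fun B hB => ?_⟩
  rw [Measure.map_apply (measurable_pi_apply i) hB]
  have h := hM {i} (fun _ => B) (fun _ _ => hB)
  rw [Finset.prod_singleton] at h
  rw [← h]
  congr 1
  ext x
  simp

variable [IsProbabilityMeasure μ]

theorem IsBernoulliProductMeasure.map_comp_injective {W : Type*} [Fintype W]
    {M : Measure (I → X)} (hM : IsBernoulliProductMeasure μ M) {j : W → I}
    (hj : Function.Injective j) :
    M.map (fun x w => x (j w)) = Measure.pi (fun _ : W => μ) := by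
  classical
  refine (Measure.pi_eq fun s hs => ?_).symm
  have hB : ∀ w, Function.extend j s (fun _ => Set.univ) (j w) = s w := fun w =>
    hj.extend_apply _ _ _
  have key := hM (Finset.univ.image j) (Function.extend j s (fun _ => Set.univ)) (by
    intro g hg
    obtain ⟨w, -, rfl⟩ := Finset.mem_image.1 hg
    rw [hB]
    exact hs w)
  rw [Finset.prod_image hj.injOn] at key
  simp only [hB] at key
  rw [Measure.map_apply (by fun_prop) (MeasurableSet.univ_pi hs), ← key]
  congr 1
  ext x
  simp [hB]

theorem isBernoulliProductMeasure_pi [Fintype I] :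
    IsBernoulliProductMeasure μ (Measure.pi fun _ : I => μ) := by
  classical
  intro E B hB
  have h : {x : I → X | ∀ g ∈ E, x g ∈ B g} =
      Set.univ.pi (fun g => if g ∈ E then B g else Set.univ) := by
    ext x
    simp only [Set.mem_ofPred_eq, Set.mem_pi, Set.mem_univ, true_imp_iff]
    refine forall_congr' fun g => ?_
    split_ifs with hg <;> simp [hg]
  rw [h, Measure.pi_pi]
  simp only [apply_ite μ, measure_univ]
  rw [Finset.prod_ite_mem, Finset.univ_inter]

theorem IsBernoulliProductMeasure.ext {M N : Measure (I → X)}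
    (hM : IsBernoulliProductMeasure μ M) (hN : IsBernoulliProductMeasure μ N) : M = N := by
  have h : ∀ {L : Measure (I → X)}, IsBernoulliProductMeasure μ L →
      IsProjectiveLimit L (fun F : Finset I => Measure.pi fun _ : F => μ) :=
    fun hL F => hL.map_comp_injective (W := F) Subtype.val_injective
  exact (h hM).unique (h hN)

/-- Events depending on finitely many coordinates have the same probability under any two
product measures, after an injective relabelling of these coordinates. -/
theorem IsBernoulliProductMeasure.preimage_comp_eq {M : Measure (I → X)} {N : Measure (G → X)}
    (hM : IsBernoulliProductMeasure μ M) (hN : IsBernoulliProductMeasure μ N)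
    {W : Finset G} {j : G → I} (hj : Set.InjOn j W) {E : Set (G → X)} (hE : MeasurableSet E)
    (hdep : DependsOn (· ∈ E) (W : Set G)) :
    M {x | (fun g => x (j g)) ∈ E} = N E := by
  classical
  obtain ⟨x₀⟩ := nonempty_of_isProbabilityMeasure μ
  let ex : (W → X) → (G → X) := fun u g => if h : g ∈ W then u ⟨g, h⟩ else x₀
  have hex : Measurable ex := by
    refine measurable_pi_lambda _ fun g => ?_
    by_cases h : g ∈ W
    · simpa [ex, h] using measurable_pi_apply _
    · simp [ex, h]
  have hmem : ∀ x : G → X, ex (fun w => x w) ∈ E ↔ x ∈ E := fun x => by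
    refine iff_of_eq (hdep fun g hg => ?_)
    have : g ∈ W := hg
    simp [ex, this]
  have h1 := hM.map_comp_injective (W := W) (j := fun w => j w)
    (fun a b hab => Subtype.ext (hj a.2 b.2 hab))
  have h2 := hN.map_comp_injective (W := W) (j := fun w => (w : G)) Subtype.val_injective
  have h3 := congrArg (fun m => m (ex ⁻¹' E)) (h1.trans h2.symm)
  rw [Measure.map_apply (by fun_prop) (hex hE), Measure.map_apply (by fun_prop) (hex hE)] at h3
  calc M {x | (fun g => x (j g)) ∈ E}
      = M ((fun (x : I → X) (w : W) => x (j w)) ⁻¹' (ex ⁻¹' E)) := by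
        congr 1
        ext x
        exact (hmem fun g => x (j g)).symm
    _ = _ := h3
    _ = N E := by
        congr 1
        ext x
        exact hmem x

theorem measurable_bernoulliShift [Group G] (g : G) :
    Measurable (bernoulliShift g : (G → X) → (G → X)) :=
  measurable_pi_lambda _ fun _ => measurable_pi_apply _

theorem IsBernoulliProductMeasure.measurePreserving_shift [Group G] {M : Measure (G → X)}
    (hM : IsBernoulliProductMeasure μ M) (g : G) :
    MeasurePreserving (bernoulliShift g : (G → X) → (G → X)) M M := by
  classical
  refine ⟨measurable_bernoulliShift g, IsBernoulliProductMeasure.ext (μ := μ) ?_ hM⟩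
  intro E B hB
  have hmeas : MeasurableSet {x : G → X | ∀ h ∈ E, x h ∈ B h} := by
    have : {x : G → X | ∀ h ∈ E, x h ∈ B h} = ⋂ h ∈ E, (fun x : G → X => x h) ⁻¹' B h := by
      ext; simp
    rw [this]
    exact Finset.measurableSet_biInter _ fun h hh => measurable_pi_apply h (hB h hh)
  rw [Measure.map_apply (measurable_bernoulliShift g) hmeas]
  have key := hM (E.image (g⁻¹ * ·)) (fun h => B (g * h)) (by
    intro h hh
    obtain ⟨k, hk, rfl⟩ := Finset.mem_image.1 hh
    simpa using hB k hk)
  rw [Finset.prod_image (mul_right_injective _).injOn] at key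
  simp only [mul_inv_cancel_left, Finset.mem_image, forall_exists_index, and_imp,
    forall_apply_eq_imp_iff₂] at key
  exact key

end ProductMeasure

section FiniteDetermination

variable {G X κ : Type*}

/-- `q x` only depends on which of the sets in `𝒮` contain `x g`, for `g ∈ F`. -/
def FinitelyDetermined (𝒮 : Finset (Set X)) (F : Finset G) (q : (G → X) → κ) : Prop :=
  ∀ x x', (∀ g ∈ F, ∀ B ∈ 𝒮, (x g ∈ B ↔ x' g ∈ B)) → q x = q x'

theorem FinitelyDetermined.mono {𝒮 𝒮' : Finset (Set X)} {F F' : Finset G} {q : (G → X) → κ}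
    (hq : FinitelyDetermined 𝒮 F q) (hS : 𝒮 ⊆ 𝒮') (hF : F ⊆ F') :
    FinitelyDetermined 𝒮' F' q :=
  fun x x' h => hq x x' fun g hg B hB => h g (hF hg) B (hS hB)

theorem FinitelyDetermined.dependsOn {𝒮 : Finset (Set X)} {F : Finset G} {q : (G → X) → κ}
    (hq : FinitelyDetermined 𝒮 F q) : DependsOn q (F : Set G) :=
  fun x x' h => hq x x' fun g hg B _ => by rw [h g hg]

/-- The point of `𝒮 → Prop` recording which sets in `𝒮` contain `x`. -/
def membershipCode (𝒮 : Finset (Set X)) (x : X) : 𝒮 → Prop := fun B => x ∈ B.1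

variable [MeasurableSpace X]

theorem measurable_membershipCode {𝒮 : Finset (Set X)} (hS : ∀ B ∈ 𝒮, MeasurableSet B) :
    Measurable (membershipCode 𝒮) :=
  measurable_pi_lambda _ fun B => measurableSet_setOfPred.1 (hS B.1 B.2)

theorem FinitelyDetermined.measurable [MeasurableSpace κ] {𝒮 : Finset (Set X)} {F : Finset G}
    {q : (G → X) → κ} (hq : FinitelyDetermined 𝒮 F q) (hS : ∀ B ∈ 𝒮, MeasurableSet B) :
    Measurable q := by
  let c : (G → X) → (F → 𝒮 → Prop) := fun x g => membershipCode 𝒮 (x g)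
  have hc : Measurable c := measurable_pi_lambda _ fun g =>
    (measurable_membershipCode hS).comp (measurable_pi_apply _)
  intro s _
  have : q ⁻¹' s = c ⁻¹' (c '' (q ⁻¹' s)) := by
    refine (Set.subset_preimage_image c _).antisymm ?_
    rintro x ⟨x', hx', hxx'⟩
    have : q x' = q x := hq x' x fun g hg B hB =>
      iff_of_eq (congrFun (congrFun hxx' ⟨g, hg⟩) ⟨B, hB⟩)
    simpa [← this] using hx'
  rw [this]
  exact hc (Set.toFinite _).measurableSet

theorem exists_finitelyDetermined_set_approx {M : Measure (G → X)} [IsFiniteMeasure M]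
    {A : Set (G → X)} (hA : MeasurableSet A) {ε : ℝ} (hε : 0 < ε) :
    ∃ (𝒮 : Finset (Set X)) (F : Finset G) (A' : Set (G → X)), (∀ B ∈ 𝒮, MeasurableSet B) ∧
      FinitelyDetermined 𝒮 F (· ∈ A') ∧ M.real (symmDiff A A') < ε := by
  classical
  let 𝒜 : Set (Set (G → X)) := {A | ∃ (𝒮 : Finset (Set X)) (F : Finset G),
    (∀ B ∈ 𝒮, MeasurableSet B) ∧ FinitelyDetermined 𝒮 F (· ∈ A)}
  have halg : IsSetAlgebra 𝒜 := by
    refine ⟨⟨∅, ∅, by simp, fun _ _ _ => rfl⟩, ?_, ?_⟩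
    · rintro s ⟨𝒮, F, hS, hs⟩
      exact ⟨𝒮, F, hS, fun x x' h => congrArg Not (hs x x' h)⟩
    · rintro s t ⟨𝒮, F, hS, hs⟩ ⟨𝒮', F', hS', ht⟩
      refine ⟨𝒮 ∪ 𝒮', F ∪ F', ?_, fun x x' h => ?_⟩
      · intro B hB
        rcases Finset.mem_union.1 hB with hB | hB
        exacts [hS B hB, hS' B hB]
      · exact congrArg₂ Or
          (hs.mono Finset.subset_union_left Finset.subset_union_left x x' h)
          (ht.mono Finset.subset_union_right Finset.subset_union_right x x' h)
  have hgen : MeasurableSpace.pi = MeasurableSpace.generateFrom 𝒜 := by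
    refine le_antisymm ?_ (MeasurableSpace.generateFrom_le ?_)
    · refine iSup_le fun g => ?_
      rintro _ ⟨B, hB, rfl⟩
      refine MeasurableSpace.measurableSet_generateFrom ⟨{B}, {g}, by simpa using hB, ?_⟩
      intro x x' h
      exact propext (h g (by simp) B (by simp))
    · rintro s ⟨𝒮, F, hS, hs⟩
      exact measurableSet_setOfPred.2 (hs.measurable hS)
  obtain ⟨A', ⟨𝒮, F, hS, hA'⟩, hlt⟩ :=
    (Measure.MeasureDense.of_generateFrom_isSetAlgebra_finite (μ := M) halg hgen).approx A hA
      (measure_ne_top _ _) ε hε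
  exact ⟨𝒮, F, A', hS, hA', (ENNReal.lt_ofReal_iff_toReal_lt (measure_ne_top _ _)).1 hlt⟩

theorem exists_finitelyDetermined_approx [Finite κ] [Nonempty κ] [MeasurableSpace κ]
    [MeasurableSingletonClass κ] {M : Measure (G → X)} [IsFiniteMeasure M]
    {q : (G → X) → κ} (hq : Measurable q) {ε : ℝ} (hε : 0 < ε) :
    ∃ (𝒮 : Finset (Set X)) (F : Finset G) (q' : (G → X) → κ), (∀ B ∈ 𝒮, MeasurableSet B) ∧
      FinitelyDetermined 𝒮 F q' ∧ M.real {x | q x ≠ q' x} ≤ ε := by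
  classical
  have := Fintype.ofFinite κ
  have hcard : 0 < (Fintype.card κ : ℝ) := by exact_mod_cast Fintype.card_pos
  choose 𝒮 F A hS hA hlt using fun k : κ =>
    exists_finitelyDetermined_set_approx (M := M) (hq (measurableSet_singleton k))
      (div_pos hε hcard)
  let q' : (G → X) → κ := fun x => Classical.epsilon fun k => x ∈ A k
  refine ⟨Finset.univ.biUnion 𝒮, Finset.univ.biUnion F, q', ?_, ?_, ?_⟩
  · intro B hB
    obtain ⟨k, -, hk⟩ := Finset.mem_biUnion.1 hB
    exact hS k B hk
  · intro x x' h
    have : (fun k => x ∈ A k) = fun k => x' ∈ A k := funext fun k =>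
      (hA k).mono (Finset.subset_biUnion_of_mem 𝒮 (Finset.mem_univ k))
        (Finset.subset_biUnion_of_mem F (Finset.mem_univ k)) x x' h
    exact congrArg Classical.epsilon this
  · have hsub : {x | q x ≠ q' x} ⊆ ⋃ k ∈ (Finset.univ : Finset κ),
        symmDiff (q ⁻¹' {k}) (A k) := by
      intro x hx
      by_contra hcon
      have hiff : ∀ k, x ∈ A k ↔ q x = k := by
        intro k
        have : x ∉ symmDiff (q ⁻¹' {k}) (A k) := fun h => hcon (by simpa using ⟨k, h⟩)
        simp only [Set.mem_symmDiff, Set.mem_preimage, Set.mem_singleton_iff] at this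
        tauto
      have hspec : x ∈ A (q' x) :=
        Classical.epsilon_spec (p := fun k => x ∈ A k) ⟨q x, (hiff _).2 rfl⟩
      exact hx ((hiff _).1 hspec)
    calc M.real {x | q x ≠ q' x}
        ≤ M.real (⋃ k ∈ (Finset.univ : Finset κ), symmDiff (q ⁻¹' {k}) (A k)) :=
          measureReal_mono hsub (measure_ne_top _ _)
      _ ≤ ∑ k : κ, M.real (symmDiff (q ⁻¹' {k}) (A k)) := measureReal_biUnion_finset_le _ _
      _ ≤ ∑ _k : κ, ε / Fintype.card κ := Finset.sum_le_sum fun k _ => (hlt k).le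
      _ = ε := by
          rw [Finset.sum_const, Finset.card_univ, nsmul_eq_mul]
          field_simp

end FiniteDetermination

section FiniteValued

variable {Ω β : Type*} [MeasurableSpace Ω] {P : Measure Ω} [IsFiniteMeasure P]
  [MeasurableSpace β] [MeasurableSingletonClass β] {U : Ω → β}

theorem integrable_comp_of_finite [Finite β] (hU : Measurable U) (φ : β → ℝ) :
    Integrable (fun ω => φ (U ω)) P :=
  (Integrable.of_finite (μ := P.map U) (f := φ)).comp_measurable hU

theorem integral_comp_of_fintype [Fintype β] (hU : Measurable U) (φ : β → ℝ) :
    ∫ ω, φ (U ω) ∂P = ∑ b, P.real (U ⁻¹' {b}) * φ b := by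
  rw [← integral_map (φ := U) hU.aemeasurable Integrable.of_finite.aestronglyMeasurable,
    integral_fintype Integrable.of_finite]
  refine Finset.sum_congr rfl fun b _ => ?_
  rw [map_measureReal_apply hU (measurableSet_singleton b), smul_eq_mul]

end FiniteValued

section Gibbs

/-- Gibbs' inequality, where `p` need only dominate the weights `J`. -/
theorem sum_mul_log_sub_log_nonneg {β : Type*} [Fintype β] {J p K : β → ℝ}
    (hJ : ∀ b, 0 ≤ J b) (hJ1 : ∑ b, J b = 1) (hJp : ∀ b, J b ≤ p b)
    (hK : ∀ b, 0 < K b) (hK1 : ∑ b, K b ≤ 1) :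
    0 ≤ ∑ b, J b * (Real.log (p b) - Real.log (K b)) := by
  have h : ∀ b, J b - K b ≤ J b * (Real.log (p b) - Real.log (K b)) := by
    intro b
    rcases (hJ b).eq_or_lt with h0 | hpos
    · simp [← h0, (hK b).le]
    have hp := hpos.trans_le (hJp b)
    rw [← Real.log_div hp.ne' (hK b).ne']
    have h1 := Real.one_sub_inv_le_log_of_pos (div_pos hp (hK b))
    rw [inv_div] at h1
    have h2 : J b * (K b / p b) ≤ K b := by
      rw [← mul_div_assoc, div_le_iff₀ hp, mul_comm]
      exact mul_le_mul_of_nonneg_left (hJp b) (hK b).le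
    nlinarith [mul_le_mul_of_nonneg_left h1 (hJ b)]
  calc (0 : ℝ) ≤ ∑ b, (J b - K b) := by
        rw [Finset.sum_sub_distrib]
        linarith
    _ ≤ _ := Finset.sum_le_sum fun b _ => h b

/-- If `x = Φ(y)` is a finite-valued function of an i.i.d. family `y`, then the entropy of `Q(y)`
is at most the cost of coding `x` letter by letter using `r`, plus the cost of coding `Q(y)`
letter by letter using `k` and a prediction of `Q(y)` from `x`. -/
theorem card_mul_entropy_le_sum_integral {I Y κ α : Type*} [Fintype I] [MeasurableSpace Y]
    (ν : Measure Y) [IsProbabilityMeasure ν]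
    [Fintype κ] [MeasurableSpace κ] [MeasurableSingletonClass κ]
    [Fintype α] [MeasurableSpace α] [MeasurableSingletonClass α]
    {Q : Y → κ} (hQ : Measurable Q) {Φ : (I → Y) → (I → α)} (hΦ : Measurable Φ)
    (pred : (I → α) → I → κ) {r : α → ℝ} (hr : ∀ a, 0 < r a) (hr1 : ∑ a, r a ≤ 1)
    {k : κ → κ → ℝ} (hk : ∀ z z', 0 < k z z') (hk1 : ∀ z', ∑ z, k z z' ≤ 1) :
    Fintype.card I * ∑ z, Real.negMulLog (ν.real (Q ⁻¹' {z})) ≤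
      ∑ v, (∫ y, -Real.log (r (Φ y v)) ∂(Measure.pi fun _ : I => ν) +
        ∫ y, -Real.log (k (Q (y v)) (pred (Φ y) v)) ∂(Measure.pi fun _ : I => ν)) := by
  classical
  set P : Measure (I → Y) := Measure.pi fun _ : I => ν with hP
  let U : (I → Y) → (I → κ) × (I → α) := fun y => (fun v => Q (y v), Φ y)
  have hU : Measurable U := by fun_prop
  let p₀ : κ → ℝ := fun z => ν.real (Q ⁻¹' {z})
  let J : (I → κ) × (I → α) → ℝ := fun w => P.real (U ⁻¹' {w})
  let p : (I → κ) × (I → α) → ℝ := fun w => ∏ v, p₀ (w.1 v)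
  let K : (I → κ) × (I → α) → ℝ := fun w => (∏ v, r (w.2 v)) * ∏ v, k (w.1 v) (pred w.2 v)
  have hJ : ∀ w, 0 ≤ J w := fun w => measureReal_nonneg
  have hJ1 : ∑ w, J w = 1 := by
    have := integral_comp_of_fintype (P := P) hU fun _ => (1 : ℝ)
    simpa [J] using this.symm
  have hJp : ∀ w, J w ≤ p w := by
    intro w
    have hsub : U ⁻¹' {w} ⊆ Set.univ.pi fun v => Q ⁻¹' {w.1 v} := by
      intro y hy v _
      exact congrFun (congrArg Prod.fst hy) v
    calc J w ≤ P.real (Set.univ.pi fun v => Q ⁻¹' {w.1 v}) :=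
          measureReal_mono hsub (measure_ne_top _ _)
      _ = p w := by
          simp only [p, p₀, Measure.real, hP, Measure.pi_pi, ENNReal.toReal_prod]
  have hK : ∀ w, 0 < K w := fun w =>
    mul_pos (Finset.prod_pos fun v _ => hr _) (Finset.prod_pos fun v _ => hk _ _)
  have hK1 : ∑ w, K w ≤ 1 := by
    rw [Fintype.sum_prod_type_right]
    calc ∑ b, ∑ a, K (a, b) ≤ ∑ b : I → α, ∏ v, r (b v) := by
          refine Finset.sum_le_sum fun b _ => ?_
          simp only [K, ← Finset.mul_sum]
          refine mul_le_of_le_one_right (Finset.prod_nonneg fun v _ => (hr _).le) ?_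
          rw [← Fintype.prod_sum fun v z => k z (pred b v)]
          exact Finset.prod_le_one (fun v _ => Finset.sum_nonneg fun z _ => (hk _ _).le)
            fun v _ => hk1 _
      _ = ∏ _v : I, ∑ a, r a := (Fintype.prod_sum fun _ a => r a).symm
      _ ≤ 1 := Finset.prod_le_one (fun v _ => Finset.sum_nonneg fun z _ => (hr _).le)
            fun v _ => hr1
  have hmain := sum_mul_log_sub_log_nonneg hJ hJ1 hJp hK hK1
  have hexpand : ∀ w, J w * (Real.log (p w) - Real.log (K w)) =
      ∑ v, J w * (Real.log (p₀ (w.1 v)) +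
        (-Real.log (r (w.2 v)) + -Real.log (k (w.1 v) (pred w.2 v)))) := by
    intro w
    rw [← Finset.mul_sum]
    rcases (hJ w).eq_or_lt with h0 | hpos
    · simp [← h0]
    have hp : ∀ v, p₀ (w.1 v) ≠ 0 := fun v =>
      Finset.prod_ne_zero_iff.1 (hpos.trans_le (hJp w)).ne' v (Finset.mem_univ v)
    congr 1
    simp only [p, K]
    rw [Real.log_mul (Finset.prod_pos fun v _ => hr _).ne'
      (Finset.prod_pos fun v _ => hk _ _).ne', Real.log_prod fun v _ => hp v,
      Real.log_prod fun v _ => (hr _).ne', Real.log_prod fun v _ => (hk _ _).ne']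
    simp only [Finset.sum_add_distrib, Finset.sum_neg_distrib]
    ring
  rw [Finset.sum_congr rfl fun w _ => hexpand w, Finset.sum_comm] at hmain
  have hterm : ∀ v, ∑ w, J w * (Real.log (p₀ (w.1 v)) +
        (-Real.log (r (w.2 v)) + -Real.log (k (w.1 v) (pred w.2 v)))) =
      -(∑ z, Real.negMulLog (ν.real (Q ⁻¹' {z}))) +
        (∫ y, -Real.log (r (Φ y v)) ∂P + ∫ y, -Real.log (k (Q (y v)) (pred (Φ y) v)) ∂P) := by
    intro v
    rw [← integral_comp_of_fintype (P := P) hU fun w => Real.log (p₀ (w.1 v)) +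
        (-Real.log (r (w.2 v)) + -Real.log (k (w.1 v) (pred w.2 v)))]
    have i1 := integrable_comp_of_finite (P := P) hU fun w => Real.log (p₀ (w.1 v))
    have i2 := integrable_comp_of_finite (P := P) hU fun w => -Real.log (r (w.2 v))
    have i3 := integrable_comp_of_finite (P := P) hU fun w =>
      -Real.log (k (w.1 v) (pred w.2 v))
    refine (integral_add i1 (i2.add i3)).trans (congrArg₂ (· + ·) ?_ (integral_add i2 i3))
    have hev : MeasurePreserving (Function.eval v) P ν := measurePreserving_eval _ v
    have hlog : AEStronglyMeasurable (fun y => Real.log (p₀ (Q y))) ν :=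
      (integrable_comp_of_finite hQ fun z => Real.log (p₀ z)).aestronglyMeasurable
    have h1 := integral_map (μ := P) hev.measurable.aemeasurable (hev.map_eq.symm ▸ hlog)
    rw [hev.map_eq] at h1
    refine h1.symm.trans ?_
    rw [integral_comp_of_fintype hQ fun z => Real.log (p₀ z), ← Finset.sum_neg_distrib]
    refine Finset.sum_congr rfl fun z _ => ?_
    simp [Real.negMulLog, p₀]
  rw [Finset.sum_congr rfl fun v _ => hterm v, Finset.sum_add_distrib, Finset.sum_const,
    Finset.card_univ, nsmul_eq_mul] at hmain
  linarith

/-- A probability vector can be made positive at a small cost in cross entropy. -/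
theorem exists_pos_cross_entropy_le {α : Type*} [Fintype α] [Nonempty α] {p : α → ℝ}
    (hp : ∀ a, 0 ≤ p a) (hp1 : ∑ a, p a = 1) {ε : ℝ} (hε : 0 < ε) :
    ∃ r : α → ℝ, (∀ a, 0 < r a) ∧ ∑ a, r a ≤ 1 ∧
      ∑ a, p a * -Real.log (r a) ≤ ∑ a, Real.negMulLog (p a) + ε := by
  have hlt : Real.exp (-ε) < 1 := by simpa using hε
  have hcard : 0 < (Fintype.card α : ℝ) := by exact_mod_cast Fintype.card_pos
  have hu : 0 < (1 - Real.exp (-ε)) / Fintype.card α := div_pos (by linarith) hcard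
  have hpos : ∀ a, 0 < Real.exp (-ε) * p a + (1 - Real.exp (-ε)) / Fintype.card α := fun a =>
    add_pos_of_nonneg_of_pos (mul_nonneg (Real.exp_pos _).le (hp a)) hu
  refine ⟨fun a => Real.exp (-ε) * p a + (1 - Real.exp (-ε)) / Fintype.card α, hpos, ?_, ?_⟩
  · rw [Finset.sum_add_distrib, ← Finset.mul_sum, hp1, Finset.sum_const, Finset.card_univ,
      nsmul_eq_mul, mul_div_cancel₀ _ hcard.ne']
    linarith
  · have : ∑ a, Real.negMulLog (p a) + ε = ∑ a, (Real.negMulLog (p a) + p a * ε) := by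
      rw [Finset.sum_add_distrib, ← Finset.sum_mul, hp1, one_mul]
    rw [this]
    refine Finset.sum_le_sum fun a _ => ?_
    rcases (hp a).eq_or_lt with h0 | h0
    · simp [← h0]
    have h1 : Real.log (Real.exp (-ε) * p a) ≤
        Real.log (Real.exp (-ε) * p a + (1 - Real.exp (-ε)) / Fintype.card α) :=
      Real.log_le_log (mul_pos (Real.exp_pos _) h0) (by linarith)
    rw [Real.log_mul (Real.exp_pos _).ne' h0.ne', Real.log_exp] at h1
    rw [Real.negMulLog]
    nlinarith [mul_le_mul_of_nonneg_left h1 (hp a)]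

/-- A positive conditional law concentrated near the diagonal, with cost `ε` on the diagonal. -/
theorem exists_pos_kernel_cost_le (κ : Type*) [Fintype κ] {ε : ℝ} (hε : 0 < ε) :
    ∃ (k : κ → κ → ℝ) (c : ℝ), (∀ z z', 0 < k z z') ∧ (∀ z', ∑ z, k z z' ≤ 1) ∧ 0 ≤ c ∧
      (∀ z, -Real.log (k z z) ≤ ε) ∧ ∀ z z', -Real.log (k z z') ≤ ε + c := by
  classical
  have hlt : Real.exp (-ε) < 1 := by simpa using hε
  have hu : ∀ _z : κ, 0 < (1 - Real.exp (-ε)) / Fintype.card κ := fun z => by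
    have : Nonempty κ := ⟨z⟩
    exact div_pos (by linarith) (by exact_mod_cast Fintype.card_pos)
  have hpos : ∀ z z' : κ,
      0 < (if z = z' then Real.exp (-ε) else 0) + (1 - Real.exp (-ε)) / Fintype.card κ := by
    intro z z'
    have := hu z
    split_ifs
    · positivity
    · linarith
  refine ⟨fun z z' => (if z = z' then Real.exp (-ε) else 0) +
    (1 - Real.exp (-ε)) / Fintype.card κ, |Real.log ((1 - Real.exp (-ε)) / Fintype.card κ)|,
    hpos, ?_, abs_nonneg _, ?_, ?_⟩
  · intro z'
    have hcard : (Fintype.card κ : ℝ) ≠ 0 := by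
      have : Nonempty κ := ⟨z'⟩
      exact_mod_cast Fintype.card_ne_zero
    rw [Finset.sum_add_distrib, Finset.sum_ite_eq' Finset.univ z' fun _ => Real.exp (-ε),
      if_pos (Finset.mem_univ _), Finset.sum_const, Finset.card_univ, nsmul_eq_mul,
      mul_div_cancel₀ _ hcard]
    linarith
  · intro z
    have := Real.log_le_log (Real.exp_pos (-ε)) (le_add_of_nonneg_right (hu z).le)
    rw [Real.log_exp] at this
    simp only [if_true]
    linarith
  · intro z z'
    have hle : (1 - Real.exp (-ε)) / Fintype.card κ ≤
        (if z = z' then Real.exp (-ε) else 0) + (1 - Real.exp (-ε)) / Fintype.card κ := by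
      split_ifs
      · linarith [Real.exp_pos (-ε)]
      · linarith
    have := Real.log_le_log (hu z) hle
    linarith [neg_abs_le (Real.log ((1 - Real.exp (-ε)) / Fintype.card κ))]

theorem integral_neg_log_kernel_le {Ω κ : Type*} [MeasurableSpace Ω] {P : Measure Ω}
    [IsProbabilityMeasure P] [Finite κ] [MeasurableSpace κ] [MeasurableSingletonClass κ]
    {k : κ → κ → ℝ} {ε c : ℝ} (hdiag : ∀ z, -Real.log (k z z) ≤ ε)
    (hk : ∀ z z', -Real.log (k z z') ≤ ε + c) {a b : Ω → κ} (ha : Measurable a)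
    (hb : Measurable b) :
    ∫ ω, -Real.log (k (a ω) (b ω)) ∂P ≤ ε + c * P.real {ω | a ω ≠ b ω} := by
  classical
  have hmeas : MeasurableSet {ω | a ω ≠ b ω} := (measurableSet_eq_fun ha hb).compl
  calc ∫ ω, -Real.log (k (a ω) (b ω)) ∂P
      ≤ ∫ ω, (ε + Set.indicator {ω | a ω ≠ b ω} (fun _ => c) ω) ∂P := by
        refine integral_mono
          (integrable_comp_of_finite (ha.prodMk hb) fun w => -Real.log (k w.1 w.2))
          ((integrable_const _).add ((integrable_const _).indicator hmeas)) fun ω => ?_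
        by_cases h : a ω = b ω
        · simpa [h] using hdiag (b ω)
        · simpa [h] using hk (a ω) (b ω)
    _ = ε + c * P.real {ω | a ω ≠ b ω} := by
        rw [integral_add (integrable_const _) ((integrable_const _).indicator hmeas),
          integral_indicator_const _ hmeas]
        simp [mul_comm]

end Gibbs

section Sofic

variable {G : Type*} [Group G]

theorem SoficApproxSeq.exists_ncard_bad_le (S : SoficApproxSeq G) (A : Finset G) {δ : ℝ}
    (hδ : 0 < δ) :
    ∃ i, ({v : Fin (S.d i) | ¬ ∀ s ∈ A, ∀ t ∈ A, S.σ i (s * t) v = S.σ i s (S.σ i t v) ∧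
      (s ≠ t → S.σ i s v ≠ S.σ i t v)}.ncard : ℝ) ≤ δ * S.d i := by
  classical
  have hcompl : ∀ p : (i : ℕ) → Fin (S.d i) → Prop,
      Tendsto (fun i => ({v : Fin (S.d i) | p i v}.ncard : ℝ) / S.d i) atTop (nhds 1) →
      Tendsto (fun i => ({v : Fin (S.d i) | ¬ p i v}.ncard : ℝ) / S.d i) atTop (nhds 0) := by
    intro p hp
    have h := hp.const_sub 1
    rw [sub_self] at h
    refine h.congr fun i => ?_
    have hd : (S.d i : ℝ) ≠ 0 := by exact_mod_cast (S.d_pos i).ne'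
    have hc := Set.ncard_add_ncard_compl {v : Fin (S.d i) | p i v}
    rw [Nat.card_fin] at hc
    have hc' : ({v : Fin (S.d i) | p i v}.ncard : ℝ) +
        ({v : Fin (S.d i) | ¬ p i v}.ncard : ℝ) = S.d i := by exact_mod_cast hc
    rw [eq_div_iff hd, sub_mul, div_mul_cancel₀ _ hd]
    linarith
  let good : G × G → (i : ℕ) → Fin (S.d i) → Prop := fun w i v =>
    S.σ i (w.1 * w.2) v = S.σ i w.1 (S.σ i w.2 v)
  let free : G × G → (i : ℕ) → Fin (S.d i) → Prop := fun w i v =>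
    w.1 ≠ w.2 → S.σ i w.1 v ≠ S.σ i w.2 v
  have h1 : ∀ w, Tendsto (fun i => ({v : Fin (S.d i) | ¬ good w i v}.ncard : ℝ) / S.d i)
      atTop (nhds 0) := fun w => hcompl _ (S.almost_mul w.1 w.2)
  have h2 : ∀ w, Tendsto (fun i => ({v : Fin (S.d i) | ¬ free w i v}.ncard : ℝ) / S.d i)
      atTop (nhds 0) := by
    intro w
    by_cases hw : w.1 = w.2
    · simp [free, hw]
    · refine hcompl _ ?_
      simpa [free, hw] using S.almost_free w.1 w.2 hw
  have hsum : Tendsto (fun i => ∑ w ∈ A ×ˢ A,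
      (({v : Fin (S.d i) | ¬ good w i v}.ncard : ℝ) / S.d i +
        ({v : Fin (S.d i) | ¬ free w i v}.ncard : ℝ) / S.d i)) atTop (nhds 0) := by
    simpa using tendsto_finsetSum (A ×ˢ A) fun w _ => (h1 w).add (h2 w)
  obtain ⟨i, hi⟩ := (hsum.eventually (gt_mem_nhds hδ)).exists
  refine ⟨i, ?_⟩
  have hd : (0 : ℝ) < S.d i := by exact_mod_cast S.d_pos i
  have hsub : {v : Fin (S.d i) | ¬ ∀ s ∈ A, ∀ t ∈ A,
      S.σ i (s * t) v = S.σ i s (S.σ i t v) ∧ (s ≠ t → S.σ i s v ≠ S.σ i t v)} ⊆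
      ⋃ w ∈ A ×ˢ A, ({v | ¬ good w i v} ∪ {v | ¬ free w i v}) := by
    intro v hv
    by_contra hcon
    refine hv fun s hs t ht => ?_
    have : v ∉ {v | ¬ good (s, t) i v} ∪ {v | ¬ free (s, t) i v} := fun h =>
      hcon (Set.mem_biUnion (x := (s, t)) (by simp [hs, ht]) h)
    simpa [not_or, good, free] using this
  have hcard : {v : Fin (S.d i) | ¬ ∀ s ∈ A, ∀ t ∈ A,
      S.σ i (s * t) v = S.σ i s (S.σ i t v) ∧ (s ≠ t → S.σ i s v ≠ S.σ i t v)}.ncard ≤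
      ∑ w ∈ A ×ˢ A, ({v | ¬ good w i v}.ncard + {v | ¬ free w i v}.ncard) :=
    (Set.ncard_le_ncard hsub (Set.toFinite _)).trans <|
      (Finset.set_ncard_biUnion_le _ _).trans <|
        Finset.sum_le_sum fun w _ => Set.ncard_union_le _ _
  have hcard' : ({v : Fin (S.d i) | ¬ ∀ s ∈ A, ∀ t ∈ A,
      S.σ i (s * t) v = S.σ i s (S.σ i t v) ∧ (s ≠ t → S.σ i s v ≠ S.σ i t v)}.ncard : ℝ) ≤
      ∑ w ∈ A ×ˢ A, (({v | ¬ good w i v}.ncard : ℝ) + ({v | ¬ free w i v}.ncard : ℝ)) := by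
    exact_mod_cast hcard
  simp only [← add_div] at hi
  rw [← Finset.sum_div, div_lt_iff₀ hd] at hi
  exact hcard'.trans hi.le

end Sofic

section EntropySup

variable {X : Type*} [MeasurableSpace X] {μ : Measure X}

theorem ofReal_sum_negMulLog_le_entropySup {α : Type*} [Fintype α] [MeasurableSpace α]
    [MeasurableSingletonClass α] {S : X → α} (hS : Measurable S) :
    ENNReal.ofReal (∑ a, Real.negMulLog (μ.real (S ⁻¹' {a}))) ≤ entropySup μ := by
  classical
  have hdisj : Pairwise (Function.onFun Disjoint fun a => S ⁻¹' {a}) := fun a b hab =>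
    Disjoint.preimage S (Set.disjoint_singleton.2 hab)
  have hsum : ∑ A ∈ Finset.univ.image (fun a => S ⁻¹' {a}), Real.negMulLog (μ A).toReal =
      ∑ a, Real.negMulLog (μ.real (S ⁻¹' {a})) :=
    Finset.sum_image_of_disjoint (g := fun A : Set X => Real.negMulLog (μ A).toReal)
      (by simp) (hdisj.set_pairwise _)
  rw [← hsum]
  refine le_iSup₂_of_le (Finset.univ.image (fun a => S ⁻¹' {a})) ⟨?_, ?_, ?_⟩ le_rfl
  · intro A hA
    obtain ⟨a, -, rfl⟩ := Finset.mem_image.1 hA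
    exact hS (measurableSet_singleton a)
  · intro A hA B hB hAB
    obtain ⟨a, -, rfl⟩ := Finset.mem_image.1 (Finset.mem_coe.1 hA)
    obtain ⟨b, -, rfl⟩ := Finset.mem_image.1 (Finset.mem_coe.1 hB)
    exact hdisj fun h => hAB (by rw [h])
  · refine Set.eq_univ_of_forall fun x => ⟨S ⁻¹' {S x}, ?_, rfl⟩
    exact Finset.mem_coe.2 (Finset.mem_image_of_mem _ (Finset.mem_univ _))

theorem exists_measurable_fiber_eq {P : Finset (Set X)} (hmeas : ∀ A ∈ P, MeasurableSet A)
    (hdisj : (P : Set (Set X)).PairwiseDisjoint id)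
    (hcover : ⋃₀ (P : Set (Set X)) = Set.univ) :
    ∃ Q : X → P, Measurable[_, ⊤] Q ∧ ∀ A : P, Q ⁻¹' {A} = A := by
  have hex : ∀ x, ∃ A : P, x ∈ A.1 := fun x => by
    obtain ⟨A, hA, hx⟩ := Set.mem_sUnion.1 (hcover.symm ▸ Set.mem_univ x)
    exact ⟨⟨A, hA⟩, hx⟩
  choose Q hQ using hex
  have hfib : ∀ A : P, Q ⁻¹' {A} = A := by
    intro A
    ext x
    refine ⟨fun h => ?_, fun h => ?_⟩
    · have : Q x = A := h
      exact this ▸ hQ x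
    · by_contra hne
      have hne' : (Q x).1 ≠ A.1 := fun h => hne (Subtype.ext h)
      exact Set.disjoint_left.1 (hdisj (Q x).2 A.2 hne') (hQ x) h
  refine ⟨Q, ?_, hfib⟩
  let _ : MeasurableSpace P := ⊤
  exact measurable_to_countable' fun A => hfib A ▸ hmeas A.1 A.2

end EntropySup

section Comparison

/-- The configuration in `A^G` seen from `v` in a labelling of a set on which `G`
approximately acts. -/
def soficPullback {G A I : Type*} [Group G] (σ : G → Equiv.Perm I) (v : I) (y : I → A) : G → A :=
  fun g => y (σ g⁻¹ v)

variable {G X Y κ : Type*} [Group G] [MeasurableSpace X] [MeasurableSpace Y]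
  {μ : Measure X} [IsProbabilityMeasure μ] {ν : Measure Y} [IsProbabilityMeasure ν]
  {μG : Measure (G → X)} {νG : Measure (G → Y)}

/-- The finite model inequality: if `f` is a coding function `Y^G → α`, and `h` a decoding
function `α^G → κ` recovering `Q (y 1)` up to a small error, then a sofic model bounds the
entropy of `Q` by the cross entropy of the code. -/
theorem entropy_le_cross_entropy_of_coding (S : SoficApproxSeq G)
    (hνG : IsBernoulliProductMeasure ν νG)
    [Fintype κ] [MeasurableSpace κ] [MeasurableSingletonClass κ]
    {α : Type*} [Fintype α] [MeasurableSpace α] [MeasurableSingletonClass α]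
    {Q : Y → κ} (hQ : Measurable Q) {F₁ F₂ : Finset G}
    {f : (G → Y) → α} (hf : Measurable f) (hfdep : DependsOn f (F₁ : Set G))
    {h : (G → α) → κ} (hh : Measurable h) (hhdep : DependsOn h (F₂ : Set G))
    {r : α → ℝ} (hr : ∀ a, 0 < r a) (hr1 : ∑ a, r a ≤ 1)
    {k : κ → κ → ℝ} {c ε : ℝ} (hε : 0 < ε) (hk : ∀ z z', 0 < k z z')
    (hk1 : ∀ z', ∑ z, k z z' ≤ 1) (hc : 0 ≤ c) (hdiag : ∀ z, -Real.log (k z z) ≤ ε)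
    (hkc : ∀ z z', -Real.log (k z z') ≤ ε + c) :
    ∑ z, Real.negMulLog (ν.real (Q ⁻¹' {z})) ≤
      ∑ a, νG.real (f ⁻¹' {a}) * -Real.log (r a) + ε +
        c * νG.real {y | Q (y 1) ≠ h fun g => f (bernoulliShift g⁻¹ y)} + ε := by
  classical
  have hr0 : ∀ a, 0 ≤ -Real.log (r a) := fun a => neg_nonneg.2 <|
    Real.log_nonpos (hr a).le <|
      (Finset.single_le_sum (fun b _ => (hr b).le) (Finset.mem_univ a)).trans hr1
  set E : Set (G → Y) := {y | Q (y 1) ≠ h fun g => f (bernoulliShift g⁻¹ y)} with hE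
  have hEmeas : MeasurableSet E := by
    have hm : Measurable fun y : G → Y => h fun g => f (bernoulliShift g⁻¹ y) :=
      hh.comp (measurable_pi_lambda _ fun g => hf.comp (measurable_bernoulliShift g⁻¹))
    exact (measurableSet_eq_fun (hQ.comp (measurable_pi_apply 1)) hm).compl
  set L : ℝ := ∑ a, -Real.log (r a) + (ε + c) with hL
  have hL0 : 0 ≤ ∑ a, -Real.log (r a) := Finset.sum_nonneg fun a _ => hr0 a
  have hLpos : 0 < L := by linarith
  set W : Finset G := {1} ∪ F₁ ∪ F₂ ∪ Finset.image₂ (· * ·) F₂ F₁ with hW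
  have h1W : (1 : G) ∈ W := by simp [hW]
  have hF₁W : ∀ s ∈ F₁, s ∈ W := fun s hs => by simp [hW, hs]
  have hF₂W : ∀ g ∈ F₂, g ∈ W := fun g hg => by simp [hW, hg]
  have hmulW : ∀ g ∈ F₂, ∀ s ∈ F₁, g * s ∈ W := fun g hg s hs =>
    Finset.mem_union_right _ (Finset.mem_image₂_of_mem hg hs)
  have hEdep : DependsOn (· ∈ E) (W : Set G) := by
    intro y y' hyy
    have e1 : y 1 = y' 1 := hyy 1 h1W
    have e2 : (h fun g => f (bernoulliShift g⁻¹ y)) = h fun g => f (bernoulliShift g⁻¹ y') := by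
      refine hhdep fun g hg => hfdep fun s hs => ?_
      change y (g⁻¹⁻¹ * s) = y' (g⁻¹⁻¹ * s)
      rw [inv_inv]
      exact hyy (g * s) (hmulW g hg s hs)
    simp only [hE, Set.mem_ofPred_eq, e1, e2]
  obtain ⟨i, hi⟩ := S.exists_ncard_bad_le (W.image (·⁻¹)) (div_pos hε hLpos)
  set n := S.d i with hn
  have hnpos : (0 : ℝ) < n := by exact_mod_cast S.d_pos i
  let σ := S.σ i
  let P : Measure (Fin n → Y) := Measure.pi fun _ => ν
  have hPB : IsBernoulliProductMeasure ν P := isBernoulliProductMeasure_pi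
  let good : Fin n → Prop := fun v => ∀ s ∈ W.image (·⁻¹), ∀ t ∈ W.image (·⁻¹),
    σ (s * t) v = σ s (σ t v) ∧ (s ≠ t → σ s v ≠ σ t v)
  have hpull : ∀ v, Measurable (soficPullback σ v : (Fin n → Y) → (G → Y)) := fun v =>
    measurable_pi_lambda _ fun _ => measurable_pi_apply _
  let Φ : (Fin n → Y) → (Fin n → α) := fun y v => f (soficPullback σ v y)
  have hΦ : Measurable Φ := measurable_pi_lambda _ fun v => hf.comp (hpull v)
  have hpull' : ∀ v, Measurable (soficPullback σ v : (Fin n → α) → (G → α)) := fun v =>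
    measurable_pi_lambda _ fun _ => measurable_pi_apply _
  let pred : (Fin n → α) → Fin n → κ := fun x v => h (soficPullback σ v x)
  have hpred : ∀ v, Measurable fun y => pred (Φ y) v := fun v =>
    hh.comp ((hpull' v).comp hΦ)
  have hmem : ∀ g ∈ W, g⁻¹ ∈ W.image (·⁻¹) := fun g hg => Finset.mem_image_of_mem _ hg
  have hinj : ∀ v, good v → Set.InjOn (fun g => σ g⁻¹ v) W := by
    intro v hv g hg g' hg' heq
    by_contra hne
    exact (hv _ (hmem g hg) _ (hmem g' hg')).2 (fun he => hne (inv_injective he)) heq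
  have hone : ∀ v, good v → σ 1 v = v := by
    intro v hv
    have h11 := (hv _ (hmem 1 h1W) _ (hmem 1 h1W)).1
    simp only [inv_one, mul_one] at h11
    exact ((σ 1).injective h11).symm
  have hlaw : ∀ v, good v → ∀ B : Set (G → Y), MeasurableSet B → DependsOn (· ∈ B) (W : Set G) →
      P.real {y | soficPullback σ v y ∈ B} = νG.real B := by
    intro v hv B hB hdep
    exact congrArg ENNReal.toReal (hPB.preimage_comp_eq hνG (hinj v hv) hB hdep)
  have hcode : ∀ v, ∫ y, -Real.log (r (Φ y v)) ∂P =
      ∑ a, P.real {y | Φ y v = a} * -Real.log (r a) := fun v =>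
    integral_comp_of_fintype (U := fun y => Φ y v) ((measurable_pi_apply v).comp hΦ)
      fun a => -Real.log (r a)
  have herr : ∀ v, ∫ y, -Real.log (k (Q (y v)) (pred (Φ y) v)) ∂P ≤
      ε + c * P.real {y | Q (y v) ≠ pred (Φ y) v} := fun v =>
    integral_neg_log_kernel_le hdiag hkc (hQ.comp (measurable_pi_apply v)) (hpred v)
  set R : ℝ := ∑ a, νG.real (f ⁻¹' {a}) * -Real.log (r a) + ε + c * νG.real E with hR
  have hR0 : 0 ≤ R := by
    have : 0 ≤ ∑ a, νG.real (f ⁻¹' {a}) * -Real.log (r a) :=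
      Finset.sum_nonneg fun a _ => mul_nonneg measureReal_nonneg (hr0 a)
    have : 0 ≤ c * νG.real E := mul_nonneg hc measureReal_nonneg
    linarith
  have hgood : ∀ v, good v → ∫ y, -Real.log (r (Φ y v)) ∂P +
      ∫ y, -Real.log (k (Q (y v)) (pred (Φ y) v)) ∂P ≤ R := by
    intro v hv
    have e1 : ∀ a, P.real {y | Φ y v = a} = νG.real (f ⁻¹' {a}) := by
      intro a
      refine hlaw v hv (f ⁻¹' {a}) (hf (measurableSet_singleton a)) fun y y' hyy => ?_
      have : f y = f y' := hfdep fun s hs => hyy s (hF₁W s hs)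
      simp [this]
    have e2 : P.real {y | Q (y v) ≠ pred (Φ y) v} = νG.real E := by
      rw [← hlaw v hv E hEmeas hEdep]
      congr 1
      ext y
      have hy1 : soficPullback σ v y 1 = y v := by simp [soficPullback, hone v hv]
      have hp : pred (Φ y) v = h fun g => f (bernoulliShift g⁻¹ (soficPullback σ v y)) := by
        refine hhdep fun g hg => hfdep fun s hs => ?_
        have := (hv _ (hmem s (hF₁W s hs)) _ (hmem g (hF₂W g hg))).1
        simp [soficPullback, bernoulliShift, this]
      simp only [hE, Set.mem_ofPred_eq, hy1, hp]
    have := herr v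
    rw [e2] at this
    rw [hcode v, Finset.sum_congr rfl fun a _ => by rw [e1 a]]
    linarith
  have hbad : ∀ v, ∫ y, -Real.log (r (Φ y v)) ∂P +
      ∫ y, -Real.log (k (Q (y v)) (pred (Φ y) v)) ∂P ≤ L := by
    intro v
    have h1 : ∑ a, P.real {y | Φ y v = a} * -Real.log (r a) ≤ ∑ a, -Real.log (r a) :=
      Finset.sum_le_sum fun a _ => mul_le_of_le_one_left (hr0 a) measureReal_le_one
    have h2 : c * P.real {y | Q (y v) ≠ pred (Φ y) v} ≤ c :=
      mul_le_of_le_one_right hc measureReal_le_one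
    rw [hcode v]
    linarith [herr v]
  have hmain := card_mul_entropy_le_sum_integral ν hQ hΦ pred hr hr1 hk hk1
  rw [Fintype.card_fin] at hmain
  have hsum : ∑ v, (∫ y, -Real.log (r (Φ y v)) ∂P +
      ∫ y, -Real.log (k (Q (y v)) (pred (Φ y) v)) ∂P) ≤ n * R + ε / L * n * L := by
    calc _ ≤ ∑ v, (R + if good v then 0 else L) := by
          refine Finset.sum_le_sum fun v _ => ?_
          split_ifs with hv
          · linarith [hgood v hv]
          · linarith [hbad v]
      _ = n * R + ({v | ¬ good v}.ncard : ℝ) * L := by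
          rw [Finset.sum_add_distrib, Finset.sum_const, Finset.card_univ, Fintype.card_fin,
            nsmul_eq_mul, Set.ncard_eq_toFinset_card']
          refine congrArg _ ?_
          rw [Finset.sum_ite, Finset.sum_const_zero, zero_add, Finset.sum_const, nsmul_eq_mul]
          congr 3
          ext v
          simp
      _ ≤ _ := by
          gcongr
  have hfin : n * ∑ z, Real.negMulLog (ν.real (Q ⁻¹' {z})) ≤ n * (R + ε) := by
    refine (hmain.trans hsum).trans (le_of_eq ?_)
    field_simp
  exact le_of_mul_le_mul_left hfin hnpos

theorem exists_entropy_le_add [IsProbabilityMeasure μG]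
    [IsProbabilityMeasure νG] (S : SoficApproxSeq G) (hμG : IsBernoulliProductMeasure μ μG)
    (hνG : IsBernoulliProductMeasure ν νG)
    {T : (G → X) → (G → Y)} {T' : (G → Y) → (G → X)} (hT : Measurable T)
    (hT' : MeasurePreserving T' νG μG) (hinv : ∀ᵐ y ∂νG, T (T' y) = y)
    (hequiv : ∀ g : G, ∀ᵐ y ∂νG, T' (bernoulliShift g y) = bernoulliShift g (T' y))
    [Fintype κ] [MeasurableSpace κ] [MeasurableSingletonClass κ]
    {Q : Y → κ} (hQ : Measurable Q) {ε : ℝ} (hε : 0 < ε) :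
    ∃ 𝒮 : Finset (Set X), (∀ B ∈ 𝒮, MeasurableSet B) ∧
      ∑ z, Real.negMulLog (ν.real (Q ⁻¹' {z})) ≤
        ∑ a, Real.negMulLog (μ.real (membershipCode 𝒮 ⁻¹' {a})) + 5 * ε := by
  classical
  have : Nonempty X := nonempty_of_isProbabilityMeasure μ
  have : Nonempty κ := (nonempty_of_isProbabilityMeasure ν).map Q
  obtain ⟨k, c, hk, hk1, hc, hdiag, hkc⟩ := exists_pos_kernel_cost_le κ hε
  set η := ε / (c + 1) with hη
  have hη0 : 0 < η := by positivity
  have hcη : c * η ≤ ε := by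
    rw [hη, mul_div_assoc', div_le_iff₀ (by linarith)]
    nlinarith
  have hq : Measurable fun x : G → X => Q (T x 1) := hQ.comp ((measurable_pi_apply 1).comp hT)
  obtain ⟨𝒮, F₂, q', hS, hq', hqq'⟩ :=
    exists_finitelyDetermined_approx (M := μG) hq (half_pos hη0)
  refine ⟨𝒮, hS, ?_⟩
  have hcode := measurable_membershipCode hS
  set p : (𝒮 → Prop) → ℝ := fun a => μ.real (membershipCode 𝒮 ⁻¹' {a}) with hp
  have hp1 : ∑ a, p a = 1 := by
    have := integral_comp_of_fintype (P := μ) hcode fun _ => (1 : ℝ)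
    simpa [hp] using this.symm
  obtain ⟨r, hr, hr1, hrp⟩ :=
    exists_pos_cross_entropy_le (p := p) (fun _ => measureReal_nonneg) hp1 hε
  have hr0 : ∀ a, 0 ≤ -Real.log (r a) := fun a => neg_nonneg.2 <|
    Real.log_nonpos (hr a).le <|
      (Finset.single_le_sum (fun b _ => (hr b).le) (Finset.mem_univ a)).trans hr1
  set L : ℝ := ∑ a, -Real.log (r a) with hL
  have hL0 : 0 ≤ L := Finset.sum_nonneg fun a _ => hr0 a
  set δ := min (ε / (L + 1)) (η / 2 / (F₂.card + 1)) with hδ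
  have hδ0 : 0 < δ := lt_min (by positivity) (by positivity)
  have hδL : δ * L ≤ ε := by
    have : δ * (L + 1) ≤ ε := (le_div_iff₀ (by linarith)).1 (min_le_left _ _)
    nlinarith
  have hδF : F₂.card * δ ≤ η / 2 := by
    have : δ * (F₂.card + 1) ≤ η / 2 := (le_div_iff₀ (by positivity)).1 (min_le_right _ _)
    nlinarith
  have hf : Measurable fun y : G → Y => membershipCode 𝒮 (T' y 1) :=
    hcode.comp ((measurable_pi_apply 1).comp hT'.measurable)
  obtain ⟨𝒮', F₁, f', hS', hf', hff'⟩ := exists_finitelyDetermined_approx (M := νG) hf hδ0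
  let pick : (𝒮 → Prop) → X := Function.invFun (membershipCode 𝒮)
  have hpick : ∀ x, membershipCode 𝒮 (pick (membershipCode 𝒮 x)) = membershipCode 𝒮 x := fun x =>
    Function.invFun_eq ⟨x, rfl⟩
  let h : (G → 𝒮 → Prop) → κ := fun u => q' fun g => pick (u g)
  have hh : Measurable h := (hq'.measurable hS).comp <|
    measurable_pi_lambda _ fun g => (measurable_of_finite pick).comp (measurable_pi_apply g)
  have hhdep : DependsOn h (F₂ : Set G) := fun u u' huu =>
    hq'.dependsOn fun g hg => congrArg pick (huu g hg)
  have hhq : ∀ x : G → X, (h fun g => membershipCode 𝒮 (x g)) = q' x := fun x =>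
    hq' _ _ fun g _ B hB => iff_of_eq (congrFun (hpick (x g)) ⟨B, hB⟩)
  have hbound := entropy_le_cross_entropy_of_coding S hνG hQ (hf'.measurable hS') hf'.dependsOn
    hh hhdep hr hr1 hε hk hk1 hc hdiag hkc
  have hfib : ∀ a, νG.real (f' ⁻¹' {a}) ≤ p a + δ := by
    intro a
    have h1 : νG.real {y | membershipCode 𝒮 (T' y 1) = a} = p a := by
      have hmp := (hμG.measurePreserving_eval (1 : G)).comp hT'
      exact congrArg ENNReal.toReal
        (hmp.measure_preimage (hcode (measurableSet_singleton a)).nullMeasurableSet)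
    have hsub : f' ⁻¹' {a} ⊆ {y | membershipCode 𝒮 (T' y 1) = a} ∪
        {y | membershipCode 𝒮 (T' y 1) ≠ f' y} := by
      intro y hy
      by_cases hne : membershipCode 𝒮 (T' y 1) = f' y
      · exact Or.inl (hne.trans hy)
      · exact Or.inr hne
    calc νG.real (f' ⁻¹' {a}) ≤ _ := measureReal_mono hsub (measure_ne_top _ _)
      _ ≤ _ := measureReal_union_le _ _
      _ ≤ p a + δ := by
          rw [h1]
          gcongr
  have hsum : ∑ a, νG.real (f' ⁻¹' {a}) * -Real.log (r a) ≤
      ∑ a, Real.negMulLog (p a) + ε + δ * L := by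
    calc _ ≤ ∑ a, (p a * -Real.log (r a) + δ * -Real.log (r a)) := by
          refine Finset.sum_le_sum fun a _ => ?_
          rw [← add_mul]
          exact mul_le_mul_of_nonneg_right (hfib a) (hr0 a)
      _ ≤ _ := by
          rw [Finset.sum_add_distrib, ← Finset.mul_sum]
          linarith
  have herr : νG.real {y | Q (y 1) ≠ h fun g => f' (bernoulliShift g⁻¹ y)} ≤ η := by
    let N : Set (G → Y) := {y | ¬ T (T' y) = y} ∪
      ⋃ g ∈ F₂, {y | ¬ T' (bernoulliShift g⁻¹ y) = bernoulliShift g⁻¹ (T' y)}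
    have hN : νG.real N = 0 := by
      refine (measureReal_eq_zero_iff (measure_ne_top _ _)).2 (measure_union_null (ae_iff.1 hinv) ?_)
      exact (measure_biUnion_null_iff F₂.countable_toSet).2 fun g _ => ae_iff.1 (hequiv g⁻¹)
    have hB : νG.real {y | Q (T (T' y) 1) ≠ q' (T' y)} ≤ η / 2 := by
      have hm : MeasurableSet {x | Q (T x 1) ≠ q' x} :=
        (measurableSet_eq_fun hq (hq'.measurable hS)).compl
      refine le_trans (le_of_eq ?_) hqq'
      exact congrArg ENNReal.toReal (hT'.measure_preimage hm.nullMeasurableSet)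
    let C : G → Set (G → Y) := fun g =>
      {y | membershipCode 𝒮 (T' (bernoulliShift g⁻¹ y) 1) ≠ f' (bernoulliShift g⁻¹ y)}
    have hC : ∀ g, νG.real (C g) ≤ δ := by
      intro g
      have hm : MeasurableSet {y | membershipCode 𝒮 (T' y 1) ≠ f' y} :=
        (measurableSet_eq_fun hf (hf'.measurable hS')).compl
      refine le_trans (le_of_eq ?_) hff'
      exact congrArg ENNReal.toReal
        ((hνG.measurePreserving_shift g⁻¹).measure_preimage hm.nullMeasurableSet)
    have hsub : {y | Q (y 1) ≠ h fun g => f' (bernoulliShift g⁻¹ y)} ⊆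
        N ∪ ({y | Q (T (T' y) 1) ≠ q' (T' y)} ∪ ⋃ g ∈ F₂, C g) := by
      intro y hy
      by_contra hcon
      simp only [N, C, Set.mem_union, Set.mem_iUnion, Set.mem_ofPred_eq, not_or, not_exists,
        not_not] at hcon
      obtain ⟨⟨hyT, hyg⟩, hyq, hyf⟩ := hcon
      refine hy ?_
      rw [← hhq, hyT] at hyq
      refine hyq.trans (hhdep fun g hg => ?_)
      rw [← hyf g hg, hyg g hg]
      simp [bernoulliShift]
    calc _ ≤ νG.real (N ∪ ({y | Q (T (T' y) 1) ≠ q' (T' y)} ∪ ⋃ g ∈ F₂, C g)) :=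
          measureReal_mono hsub (measure_ne_top _ _)
      _ ≤ νG.real N + (νG.real {y | Q (T (T' y) 1) ≠ q' (T' y)} + νG.real (⋃ g ∈ F₂, C g)) :=
          (measureReal_union_le _ _).trans (by gcongr; exact measureReal_union_le _ _)
      _ ≤ 0 + (η / 2 + ∑ g ∈ F₂, δ) := by
          rw [hN]
          gcongr
          exact (measureReal_biUnion_finset_le _ _).trans (Finset.sum_le_sum fun g _ => hC g)
      _ ≤ η := by
          rw [Finset.sum_const, nsmul_eq_mul]
          linarith
  have := mul_le_mul_of_nonneg_left herr hc
  linarith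

/-- A Bernoulli shift with base `ν` that embeds in the one with base `μ`, with a measurable left
inverse, has no larger base entropy. -/
theorem entropySup_le_of_equivariant_embedding [IsProbabilityMeasure μG]
    [IsProbabilityMeasure νG] (S : SoficApproxSeq G)
    (hμG : IsBernoulliProductMeasure μ μG) (hνG : IsBernoulliProductMeasure ν νG)
    {T : (G → X) → (G → Y)} {T' : (G → Y) → (G → X)} (hT : Measurable T)
    (hT' : MeasurePreserving T' νG μG) (hinv : ∀ᵐ y ∂νG, T (T' y) = y)
    (hequiv : ∀ g : G, ∀ᵐ y ∂νG, T' (bernoulliShift g y) = bernoulliShift g (T' y)) :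
    entropySup ν ≤ entropySup μ := by
  classical
  refine iSup₂_le fun P hP => ?_
  obtain ⟨Q, hQ, hfib⟩ := exists_measurable_fiber_eq hP.1 hP.2.1 hP.2.2
  let _ : MeasurableSpace P := ⊤
  have hsum : ∑ A ∈ P, Real.negMulLog (ν A).toReal =
      ∑ A : P, Real.negMulLog (ν.real (Q ⁻¹' {A})) := by
    rw [← Finset.sum_coe_sort]
    exact Finset.sum_congr rfl fun A _ => by rw [hfib]; rfl
  rw [hsum]
  refine ENNReal.le_of_forall_pos_le_add fun ε hε _ => ?_
  have hε' : (0 : ℝ) < ε := hε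
  obtain ⟨𝒮, hS, hle⟩ := exists_entropy_le_add S hμG hνG hT hT' hinv hequiv hQ
    (div_pos hε' (by norm_num : (0 : ℝ) < 5))
  rw [mul_div_cancel₀ _ (by norm_num : (5 : ℝ) ≠ 0)] at hle
  calc _ ≤ ENNReal.ofReal (∑ a, Real.negMulLog (μ.real (membershipCode 𝒮 ⁻¹' {a})) + ε) :=
        ENNReal.ofReal_le_ofReal hle
    _ ≤ _ := ENNReal.ofReal_add_le
    _ ≤ entropySup μ + ε := by
        gcongr
        · exact ofReal_sum_negMulLog_le_entropySup (measurable_membershipCode hS)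
        · simp

theorem measurable_piecewise_const {A B : Type*} [MeasurableSpace A] [MeasurableSpace B]
    {s : Set A} [DecidablePred (· ∈ s)] (hs : MeasurableSet s) {T : A → B}
    (hT : ∀ t, MeasurableSet t → MeasurableSet (s ∩ T ⁻¹' t)) (b : B) :
    Measurable (s.piecewise T fun _ => b) := by
  intro t ht
  rw [Set.piecewise_preimage, Set.ite, Set.inter_comm]
  exact (hT t ht).union ((measurable_const ht).diff hs)

end Comparison

/-- Let `G` be a countable sofic group and `(X,μ)`, `(Y,ν)` standard probability spaces.
If the Bernoulli actions `(G, X^G, μ^G)` and `(G, Y^G, ν^G)` are isomorphic — i.e. there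
are `G`-invariant Borel sets `X' ⊆ X^G`, `Y' ⊆ Y^G` of full measure and a Borel bijection
`T : X' → Y'` with Borel inverse, pushing `μ^G|_{X'}` to `ν^G|_{Y'}` and intertwining the
shift actions — then `H(μ) = H(ν)`. -/
theorem entropy_eq_of_bernoulli_isomorphic {G : Type*} [Group G] [Countable G]
    (hsofic : Nonempty (SoficApproxSeq G))
    {X Y : Type*} [MeasurableSpace X] [StandardBorelSpace X]
    [MeasurableSpace Y] [StandardBorelSpace Y]
    (μ : Measure X) [IsProbabilityMeasure μ] (ν : Measure Y) [IsProbabilityMeasure ν]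
    (μG : Measure (G → X)) [IsProbabilityMeasure μG] (hμG : IsBernoulliProductMeasure μ μG)
    (νG : Measure (G → Y)) [IsProbabilityMeasure νG] (hνG : IsBernoulliProductMeasure ν νG)
    (X' : Set (G → X)) (Y' : Set (G → Y))
    (hX'm : MeasurableSet X') (hY'm : MeasurableSet Y')
    (hX'inv : ∀ g : G, ∀ x ∈ X', bernoulliShift g x ∈ X')
    (hY'inv : ∀ g : G, ∀ y ∈ Y', bernoulliShift g y ∈ Y')
    (hX'full : μG X' = 1) (hY'full : νG Y' = 1)
    (T : (G → X) → (G → Y)) (T' : (G → Y) → (G → X))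
    (hbij : Set.BijOn T X' Y') (hinv : Set.InvOn T' T X' Y')
    (hTmeas : ∀ B : Set (G → Y), MeasurableSet B → MeasurableSet (X' ∩ T ⁻¹' B))
    (hT'meas : ∀ A : Set (G → X), MeasurableSet A → MeasurableSet (Y' ∩ T' ⁻¹' A))
    (hTpush : ∀ B : Set (G → Y), MeasurableSet B → μG (X' ∩ T ⁻¹' B) = νG (Y' ∩ B))
    (hTequiv : ∀ g : G, ∀ x ∈ X', T (bernoulliShift g x) = bernoulliShift g (T x)) :
    entropySup μ = entropySup ν := by
  classical
  obtain ⟨S⟩ := hsofic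
  obtain ⟨x₀⟩ := nonempty_of_isProbabilityMeasure μG
  obtain ⟨y₀⟩ := nonempty_of_isProbabilityMeasure νG
  have hXae : ∀ᵐ x ∂μG, x ∈ X' := (prob_compl_eq_zero_iff hX'm).2 hX'full
  have hYae : ∀ᵐ y ∂νG, y ∈ Y' := (prob_compl_eq_zero_iff hY'm).2 hY'full
  have hmaps : ∀ x ∈ X', T x ∈ Y' := fun x hx => hbij.mapsTo hx
  have hmaps' : ∀ y ∈ Y', T' y ∈ X' := by
    intro y hy
    obtain ⟨x, hx, rfl⟩ := hbij.surjOn hy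
    rwa [hinv.1 hx]
  have hT'equiv : ∀ g : G, ∀ y ∈ Y', T' (bernoulliShift g y) = bernoulliShift g (T' y) := by
    intro g y hy
    obtain ⟨x, hx, rfl⟩ := hbij.surjOn hy
    rw [← hTequiv g x hx, hinv.1 (hX'inv g x hx), hinv.1 hx]
  have hU : Measurable (X'.piecewise T fun _ => y₀) := measurable_piecewise_const hX'm hTmeas y₀
  have hU' : Measurable (Y'.piecewise T' fun _ => x₀) :=
    measurable_piecewise_const hY'm hT'meas x₀
  have hUX : ∀ x ∈ X', (X'.piecewise T fun _ => y₀) x = T x := fun x hx =>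
    Set.piecewise_eq_of_mem _ _ _ hx
  have hUY : ∀ y ∈ Y', (Y'.piecewise T' fun _ => x₀) y = T' y := fun y hy =>
    Set.piecewise_eq_of_mem _ _ _ hy
  have hX0 : ∀ A, μG (X' ∩ A) = μG A := fun A =>
    Measure.measure_inter_eq_of_ae hXae
  have hY0 : ∀ B, νG (Y' ∩ B) = νG B := fun B =>
    Measure.measure_inter_eq_of_ae hYae
  have hpres : MeasurePreserving (X'.piecewise T fun _ => y₀) μG νG := by
    refine ⟨hU, Measure.ext fun B hB => ?_⟩
    rw [Measure.map_apply hU hB, ← hY0 B, ← hTpush B hB, ← hX0]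
    congr 1
    ext x
    refine and_congr_right fun hx => ?_
    rw [Set.mem_preimage, Set.mem_preimage, hUX x hx]
  have hpres' : MeasurePreserving (Y'.piecewise T' fun _ => x₀) νG μG := by
    refine ⟨hU', Measure.ext fun A hA => ?_⟩
    rw [Measure.map_apply hU' hA, ← hX0 A, ← hY0]
    have hset : Y' ∩ (Y'.piecewise T' fun _ => x₀) ⁻¹' A = Y' ∩ (Y' ∩ T' ⁻¹' A) := by
      ext y
      simp +contextual
    rw [hset, ← hTpush _ (hT'meas A hA)]
    congr 1
    ext x
    refine and_congr_right fun hx => ?_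
    simp [hmaps x hx, hinv.1 hx]
  refine le_antisymm ?_ ?_
  · refine entropySup_le_of_equivariant_embedding S hνG hμG hU' hpres ?_ fun g => ?_
    · filter_upwards [hXae] with x hx
      rw [hUX x hx, hUY _ (hmaps x hx), hinv.1 hx]
    · filter_upwards [hXae] with x hx
      rw [hUX x hx, hUX _ (hX'inv g x hx), hTequiv g x hx]
  · refine entropySup_le_of_equivariant_embedding S hμG hνG hU hpres' ?_ fun g => ?_
    · filter_upwards [hYae] with y hy
      rw [hUY y hy, hUX _ (hmaps' y hy), hinv.2 hy]
    · filter_upwards [hYae] with y hy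
      rw [hUY y hy, hUY _ (hY'inv g y hy), hT'equiv g y hy]
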